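/- arXiv:1808.02941 — 8 statements merged into one kernel-verified Lean document; each statement's English description precedes it below -/
import Mathlib

section
/- For every integer t > 1, the auxiliary sequence satisfies z_{t+1} − z_t = −(β_{1,t+1}/(1−β_{1,t+1}) − β_{1,t}/(1−β_{1,t})) · α_t m_t/√v̂_t − (β_{1,t}/(1−β_{1,t})) · (α_t/√v̂_t − α_{t−1}/√v̂_{t−1}) ⊙ m_{t−1} − α_t g_t/√v̂_t, and moreover z_2 − z_1 = −(β_{1,2}/(1−β_{1,2}) − β_{1,1}/(1−β_{1,1})) · α_1 m_1/√v̂_1 − α_1 g_1/√v̂_1. -/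
/-- The momentum recursion, divided by `1 - β`. -/
theorem one_add_div_one_sub_mul_momentum {β m m' g : ℝ} (hβ : β < 1)
    (hm : m' = β * m + (1 - β) * g) :
    (1 + β / (1 - β)) * m' = β / (1 - β) * m + g := by
  have h : 1 - β ≠ 0 := (sub_pos.2 hβ).ne'
  rw [hm]
  field_simp
  ring

/-- Lemma on the auxiliary sequence `z_t` of generalized Adam.
Vectors live in `ℝ^d` as `Fin d → ℝ`; all vector operations are elementwise. -/
theorem generalized_adam_z_recursion
    {d : ℕ} (hd : 1 ≤ d)
    (α β1 : ℕ → ℝ)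
    (hα : ∀ t, 1 ≤ t → 0 < α t)
    (hβ : ∀ t, 1 ≤ t → 0 ≤ β1 t ∧ β1 t < 1)
    (g vhat : ℕ → Fin d → ℝ)
    (hvpos : ∀ t, 1 ≤ t → ∀ j, 0 < vhat t j)
    (m x z : ℕ → Fin d → ℝ)
    (hm0 : m 0 = 0)
    (hm : ∀ t, 1 ≤ t → m t = β1 t • m (t - 1) + (1 - β1 t) • g t)
    (hx0 : x 0 = x 1)
    (hx : ∀ t, 1 ≤ t → x (t + 1) = x t - fun j => α t * m t j / Real.sqrt (vhat t j))
    (hz : ∀ t, 1 ≤ t → z t = x t + (β1 t / (1 - β1 t)) • (x t - x (t - 1))) :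
    (∀ t, 1 < t →
      z (t + 1) - z t =
        -((β1 (t + 1) / (1 - β1 (t + 1)) - β1 t / (1 - β1 t)) •
            fun j => α t * m t j / Real.sqrt (vhat t j))
        - (β1 t / (1 - β1 t)) •
            (fun j => (α t / Real.sqrt (vhat t j) - α (t - 1) / Real.sqrt (vhat (t - 1) j)) * m (t - 1) j)
        - fun j => α t * g t j / Real.sqrt (vhat t j))
    ∧
    z 2 - z 1 =
      -((β1 2 / (1 - β1 2) - β1 1 / (1 - β1 1)) •
          fun j => α 1 * m 1 j / Real.sqrt (vhat 1 j))
      - fun j => α 1 * g 1 j / Real.sqrt (vhat 1 j) := by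
  have key : ∀ t, 1 ≤ t → ∀ j,
      (1 + β1 t / (1 - β1 t)) * m t j = β1 t / (1 - β1 t) * m (t - 1) j + g t j := fun t ht j =>
    one_add_div_one_sub_mul_momentum (hβ t ht).2 (by simpa using congrFun (hm t ht) j)
  have hxj : ∀ t, 1 ≤ t → ∀ j, x (t + 1) j = x t j - α t * m t j / Real.sqrt (vhat t j) :=
    fun t ht j => congrFun (hx t ht) j
  have hzj : ∀ t, 1 ≤ t → ∀ j,
      z t j = x t j + β1 t / (1 - β1 t) * (x t j - x (t - 1) j) :=
    fun t ht j => congrFun (hz t ht) j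
  refine ⟨fun t ht => ?_, ?_⟩
  · obtain ⟨s, rfl⟩ : ∃ s, t = s + 2 := ⟨t - 2, by omega⟩
    ext j
    have hk := key (s + 2) (by omega) j
    have h1 := hxj (s + 1) (by omega) j
    have h2 := hxj (s + 2) (by omega) j
    have h3 := hzj (s + 2) (by omega) j
    have h4 := hzj (s + 2 + 1) (by omega) j
    simp only [Nat.add_succ_sub_one, add_assoc, Nat.reduceAdd,
      Pi.sub_apply, Pi.neg_apply, Pi.smul_apply, smul_eq_mul] at hk h1 h2 h3 h4 ⊢
    rw [h4, h3, h2, h1]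
    linear_combination -(α (s + 2) / Real.sqrt (vhat (s + 2) j)) * hk
  · ext j
    have hk := key 1 le_rfl j
    have h2 := hxj 1 le_rfl j
    have h3 := hzj 1 le_rfl j
    have h4 := hzj 2 one_le_two j
    simp only [Nat.sub_self, Nat.add_one_sub_one, Nat.reduceAdd, hm0, hx0,
      Pi.zero_apply, Pi.sub_apply, Pi.neg_apply, Pi.smul_apply, smul_eq_mul] at hk h2 h3 h4 ⊢
    rw [h4, h3, h2]
    linear_combination -(α 1 / Real.sqrt (vhat 1 j)) * hk
end

section
/- For every t ≥ 1, E[f(z_{t+1}) − f(z_1)] ≤ T1 + T2 + T3 + T4 + T5 + T6, where T1 = −E[∑_{i=1}^{t} ⟨∇f(z_i), (β_{1,i}/(1−β_{1,i}))(α_i/√v̂_i − α_{i−1}/√v̂_{i−1}) ⊙ m_{i−1}⟩], T2 = −E[∑_{i=1}^{t} α_i ⟨∇f(z_i), g_i/√v̂_i⟩], T3 = −E[∑_{i=1}^{t} ⟨∇f(z_i), (β_{1,i+1}/(1−β_{1,i+1}) − β_{1,i}/(1−β_{1,i})) α_i m_i/√v̂_i⟩], T4 = (3L/2)·E[∑_{i=1}^{t}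 ‖(β_{1,i+1}/(1−β_{1,i+1}) − β_{1,i}/(1−β_{1,i})) α_i m_i/√v̂_i‖²], T5 = (3L/2)·E[∑_{i=1}^{t} ‖(β_{1,i}/(1−β_{1,i}))(α_i/√v̂_i − α_{i−1}/√v̂_{i−1}) ⊙ m_{i−1}‖²], and T6 = (3L/2)·E[∑_{i=1}^{t} ‖α_i g_i/√v̂_i‖²]. -/
open MeasureTheory Finset ProbabilityTheory
open scoped RealInnerProductSpace

/-- The vector `a/√v ∈ ℝ^d` (elementwise). -/
noncomputable def stepVec {d : ℕ} (a : ℝ) (v : EuclideanSpace ℝ (Fin d)) :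
    EuclideanSpace ℝ (Fin d) :=
  (EuclideanSpace.equiv (Fin d) ℝ).symm fun j => a / Real.sqrt (v j)

/-- Elementwise (Hadamard) product `x ⊙ y`. -/
noncomputable def hadamardVec {d : ℕ} (x y : EuclideanSpace ℝ (Fin d)) :
    EuclideanSpace ℝ (Fin d) :=
  (EuclideanSpace.equiv (Fin d) ℝ).symm fun j => x j * y j

/-- Quadratic upper bound for a function with `L`-Lipschitz gradient. -/
theorem sub_le_inner_add_of_lipschitz_gradient {E : Type*} [NormedAddCommGroup E]
    [InnerProductSpace ℝ E] [CompleteSpace E] {f : E → ℝ} {f' : E → E}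
    (hf : ∀ p, HasGradientAt f (f' p) p) {L : ℝ}
    (hL : ∀ p q, ‖f' p - f' q‖ ≤ L * ‖p - q‖) (p v : E) :
    f (p + v) - f p ≤ ⟪f' p, v⟫ + L / 2 * ‖v‖ ^ 2 := by
  set φ : ℝ → ℝ := fun s => f (p + s • v) - s * ⟪f' p, v⟫ - s ^ 2 * (L / 2 * ‖v‖ ^ 2)
  have hline : ∀ s : ℝ, HasDerivAt (fun s : ℝ => p + s • v) v s := fun s => by
    simpa using ((hasDerivAt_id s).smul_const v).const_add p
  have hφ : ∀ s : ℝ, HasDerivAt φ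
      (⟪f' (p + s • v), v⟫ - ⟪f' p, v⟫ - 2 * s * (L / 2 * ‖v‖ ^ 2)) s := fun s => by
    have h1 := (hf (p + s • v)).hasFDerivAt.comp_hasDerivAt s (hline s)
    have h2 := (hasDerivAt_id s).mul_const ⟪f' p, v⟫
    have h3 := ((hasDerivAt_id s).pow 2).mul_const (L / 2 * ‖v‖ ^ 2)
    refine ((h1.sub h2).sub h3).congr_deriv ?_
    simp
  have hanti : AntitoneOn φ (Set.Ici 0) := by
    refine antitoneOn_of_deriv_nonpos (convex_Ici 0)
      (fun s _ => (hφ s).continuousAt.continuousWithinAt)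
      (fun s _ => (hφ s).differentiableAt.differentiableWithinAt) fun s hs => ?_
    rw [interior_Ici, Set.mem_Ioi] at hs
    rw [(hφ s).deriv, ← inner_sub_left]
    have h1 := real_inner_le_norm (f' (p + s • v) - f' p) v
    have h2 := hL (p + s • v) p
    rw [add_sub_cancel_left, norm_smul, Real.norm_of_nonneg hs.le] at h2
    nlinarith [mul_le_mul_of_nonneg_right h2 (norm_nonneg v)]
  have h := hanti Set.self_mem_Ici (Set.mem_Ici.2 zero_le_one) zero_le_one
  simp only [φ, one_smul, zero_smul, add_zero] at h
  linarith

theorem norm_add_add_sq_le {E : Type*} [SeminormedAddCommGroup E] (a b c : E) :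
    ‖a + b + c‖ ^ 2 ≤ 3 * (‖a‖ ^ 2 + ‖b‖ ^ 2 + ‖c‖ ^ 2) := by
  nlinarith [norm_add₃_le (a := a) (b := b) (c := c), norm_nonneg (a + b + c),
    sq_nonneg (‖a‖ - ‖b‖), sq_nonneg (‖b‖ - ‖c‖), sq_nonneg (‖a‖ - ‖c‖)]

theorem nonneg_of_norm_sub_le {E F : Type*} [NormedAddCommGroup E] [Nontrivial E]
    [SeminormedAddCommGroup F] {f : E → F} {L : ℝ}
    (h : ∀ p q, ‖f p - f q‖ ≤ L * ‖p - q‖) : 0 ≤ L := by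
  obtain ⟨p, q, hpq⟩ := exists_pair_ne E
  exact nonneg_of_mul_nonneg_left ((norm_nonneg _).trans (h p q)) (norm_sub_pos_iff.2 hpq)

theorem integral_le_of_le_neg_add_const_mul {Ω : Type*} [MeasurableSpace Ω] {μ : Measure Ω}
    {F A₁ A₂ A₃ B₁ B₂ B₃ : Ω → ℝ} {c : ℝ} (hF : Integrable F μ) (hA₁ : Integrable A₁ μ)
    (hA₂ : Integrable A₂ μ) (hA₃ : Integrable A₃ μ) (hB₁ : Integrable B₁ μ)
    (hB₂ : Integrable B₂ μ) (hB₃ : Integrable B₃ μ)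
    (h : ∀ ω, F ω ≤ -A₁ ω + -A₂ ω + -A₃ ω + c * B₁ ω + c * B₂ ω + c * B₃ ω) :
    ∫ ω, F ω ∂μ ≤ -(∫ ω, A₁ ω ∂μ) + -(∫ ω, A₂ ω ∂μ) + -(∫ ω, A₃ ω ∂μ)
      + c * (∫ ω, B₁ ω ∂μ) + c * (∫ ω, B₂ ω ∂μ) + c * (∫ ω, B₃ ω ∂μ) := by
  have i₂ := hA₁.neg.add hA₂.neg
  have i₃ := i₂.add hA₃.neg
  have i₄ := i₃.add (hB₁.const_mul c)
  have i₅ := i₄.add (hB₂.const_mul c)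
  have hle := integral_mono hF (i₅.add (hB₃.const_mul c)) h
  rw [integral_add' i₅ (hB₃.const_mul c), integral_add' i₄ (hB₂.const_mul c),
    integral_add' i₃ (hB₁.const_mul c), integral_add' i₂ hA₃.neg,
    integral_add' hA₁.neg hA₂.neg] at hle
  simpa only [integral_neg', integral_const_mul] using hle

@[simp]
theorem stepVec_apply {d : ℕ} (a : ℝ) (v : EuclideanSpace ℝ (Fin d)) (j : Fin d) :
    stepVec a v j = a / Real.sqrt (v j) := rfl

@[simp]
theorem hadamardVec_apply {d : ℕ} (x y : EuclideanSpace ℝ (Fin d)) (j : Fin d) :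
    hadamardVec x y j = x j * y j := rfl

theorem hadamardVec_stepVec_eq_smul {d : ℕ} (a : ℝ) (v y : EuclideanSpace ℝ (Fin d)) :
    hadamardVec (stepVec a v) y = a • hadamardVec (stepVec 1 v) y := by
  ext j
  simp
  ring

/-- One step of the auxiliary sequence of a momentum method, with elementwise stepsizes `s`
(current) and `s'` (previous) and momenta `m`, `m'`: here `b = β / (1 - β)`, and `c` is its next value. -/
theorem auxiliary_step {d : ℕ} {β b c : ℝ} (hβ : β < 1) (hb : b = β / (1 - β))
    {s s' m m' g x y w z z' : EuclideanSpace ℝ (Fin d)}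
    (hm : m = β • m' + (1 - β) • g) (hxw : x - w = -hadamardVec s' m')
    (hy : y = x - hadamardVec s m) (hz : z = x + b • (x - w)) (hz' : z' = y + c • (y - x)) :
    z' = z + -((c - b) • hadamardVec s m + b • hadamardVec (s - s') m' + hadamardVec s g) := by
  have h1 : 1 - β ≠ 0 := by linarith
  rw [hxw] at hz
  subst hz hz' hy hm hb
  ext j
  simp
  field_simp
  ring

/-- Lemma A.2 of the paper: expected descent inequality
`E[f(z_{t+1}) - f(z_1)] ≤ T1 + T2 + T3 + T4 + T5 + T6` for generalized Adam.
Here `α_i m_i/√v̂_i = (α_i/√v̂_i) ⊙ m_i`, `g_i/√v̂_i = (1/√v̂_i) ⊙ g_i`, etc. -/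
theorem generalized_adam_descent_lemma
    {d : ℕ} (hd : 1 ≤ d)
    {Ω : Type} [MeasurableSpace Ω] (μ : Measure Ω) [IsProbabilityMeasure μ]
    (α β1 : ℕ → ℝ)
    (hα : ∀ t, 1 ≤ t → 0 < α t)
    (hβ : ∀ t, 1 ≤ t → 0 ≤ β1 t ∧ β1 t < 1)
    (g vhat m x z : ℕ → Ω → EuclideanSpace ℝ (Fin d))
    (hgmeas : ∀ t, Measurable (g t))
    -- v̂_t is a measurable function of (g_1, …, g_t)
    (hvfun : ∀ t, 1 ≤ t →
      ∃ h : (Fin t → EuclideanSpace ℝ (Fin d)) → EuclideanSpace ℝ (Fin d),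
        Measurable h ∧ ∀ ω, vhat t ω = h fun i => g (i + 1) ω)
    (hvpos : ∀ t, 1 ≤ t → ∀ ω, ∀ j, 0 < vhat t ω j)
    -- Algorithm 1 recursions
    (hm0 : ∀ ω, m 0 ω = 0)
    (hm : ∀ t, 1 ≤ t → ∀ ω, m t ω = β1 t • m (t - 1) ω + (1 - β1 t) • g t ω)
    (x1 : EuclideanSpace ℝ (Fin d)) (hx1 : ∀ ω, x 1 ω = x1)
    (hx0 : ∀ ω, x 0 ω = x 1 ω)
    (hx : ∀ t, 1 ≤ t → ∀ ω,
      x (t + 1) ω = x t ω - hadamardVec (stepVec (α t) (vhat t ω)) (m t ω))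
    (hz : ∀ t, 1 ≤ t → ∀ ω,
      z t ω = x t ω + (β1 t / (1 - β1 t)) • (x t ω - x (t - 1) ω))
    -- Assumptions A1, A2
    (f : EuclideanSpace ℝ (Fin d) → ℝ)
    (gradf : EuclideanSpace ℝ (Fin d) → EuclideanSpace ℝ (Fin d))
    (hgrad : ∀ p, HasGradientAt f (gradf p) p)
    (L : ℝ) (hLip : ∀ p q, ‖gradf p - gradf q‖ ≤ L * ‖p - q‖)
    (hbdd : BddBelow (Set.range f))
    (H : ℝ) (hgradbd : ∀ p, ‖gradf p‖ ≤ H)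
    (hgbd : ∀ t, 1 ≤ t → ∀ᵐ ω ∂μ, ‖g t ω‖ ≤ H)
    (t : ℕ) (ht : 1 ≤ t)
    -- integrability of all quantities whose expectations appear
    (hint0 : ∀ i, Integrable (fun ω => f (z i ω)) μ)
    (hint1 : Integrable (fun ω => ∑ i ∈ Finset.Icc 1 t,
      ⟪gradf (z i ω), (β1 i / (1 - β1 i)) •
        hadamardVec (stepVec (α i) (vhat i ω) - stepVec (α (i - 1)) (vhat (i - 1) ω))
          (m (i - 1) ω)⟫) μ)
    (hint2 : Integrable (fun ω => ∑ i ∈ Finset.Icc 1 t,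
      α i * ⟪gradf (z i ω), hadamardVec (stepVec 1 (vhat i ω)) (g i ω)⟫) μ)
    (hint3 : Integrable (fun ω => ∑ i ∈ Finset.Icc 1 t,
      ⟪gradf (z i ω), (β1 (i + 1) / (1 - β1 (i + 1)) - β1 i / (1 - β1 i)) •
        hadamardVec (stepVec (α i) (vhat i ω)) (m i ω)⟫) μ)
    (hint4 : Integrable (fun ω => ∑ i ∈ Finset.Icc 1 t,
      ‖(β1 (i + 1) / (1 - β1 (i + 1)) - β1 i / (1 - β1 i)) •
        hadamardVec (stepVec (α i) (vhat i ω)) (m i ω)‖ ^ 2) μ)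
    (hint5 : Integrable (fun ω => ∑ i ∈ Finset.Icc 1 t,
      ‖(β1 i / (1 - β1 i)) •
        hadamardVec (stepVec (α i) (vhat i ω) - stepVec (α (i - 1)) (vhat (i - 1) ω))
          (m (i - 1) ω)‖ ^ 2) μ)
    (hint6 : Integrable (fun ω => ∑ i ∈ Finset.Icc 1 t,
      ‖hadamardVec (stepVec (α i) (vhat i ω)) (g i ω)‖ ^ 2) μ) :
    (∫ ω, (f (z (t + 1) ω) - f (z 1 ω)) ∂μ) ≤
      -(∫ ω, (∑ i ∈ Finset.Icc 1 t,
          ⟪gradf (z i ω), (β1 i / (1 - β1 i)) •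
            hadamardVec (stepVec (α i) (vhat i ω) - stepVec (α (i - 1)) (vhat (i - 1) ω))
              (m (i - 1) ω)⟫) ∂μ)
      + -(∫ ω, (∑ i ∈ Finset.Icc 1 t,
          α i * ⟪gradf (z i ω), hadamardVec (stepVec 1 (vhat i ω)) (g i ω)⟫) ∂μ)
      + -(∫ ω, (∑ i ∈ Finset.Icc 1 t,
          ⟪gradf (z i ω), (β1 (i + 1) / (1 - β1 (i + 1)) - β1 i / (1 - β1 i)) •
            hadamardVec (stepVec (α i) (vhat i ω)) (m i ω)⟫) ∂μ)
      + (3 * L / 2) * (∫ ω, (∑ i ∈ Finset.Icc 1 t,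
          ‖(β1 (i + 1) / (1 - β1 (i + 1)) - β1 i / (1 - β1 i)) •
            hadamardVec (stepVec (α i) (vhat i ω)) (m i ω)‖ ^ 2) ∂μ)
      + (3 * L / 2) * (∫ ω, (∑ i ∈ Finset.Icc 1 t,
          ‖(β1 i / (1 - β1 i)) •
            hadamardVec (stepVec (α i) (vhat i ω) - stepVec (α (i - 1)) (vhat (i - 1) ω))
              (m (i - 1) ω)‖ ^ 2) ∂μ)
      + (3 * L / 2) * (∫ ω, (∑ i ∈ Finset.Icc 1 t,
          ‖hadamardVec (stepVec (α i) (vhat i ω)) (g i ω)‖ ^ 2) ∂μ) := by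
  have : Nonempty (Fin d) := ⟨⟨0, hd⟩⟩
  have hL : 0 ≤ L := nonneg_of_norm_sub_le hLip
  have hprev : ∀ i, 1 ≤ i → ∀ ω, x i ω - x (i - 1) ω =
      -hadamardVec (stepVec (α (i - 1)) (vhat (i - 1) ω)) (m (i - 1) ω) := by
    intro i hi ω
    obtain rfl | hi := hi.eq_or_lt
    · ext j
      simp [hx0, hm0]
    · obtain ⟨k, rfl⟩ := Nat.exists_eq_add_of_le' hi.le
      simp [hx k (by omega)]
  have hstep : ∀ i, 1 ≤ i → ∀ ω, z (i + 1) ω = z i ω +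
      -((β1 (i + 1) / (1 - β1 (i + 1)) - β1 i / (1 - β1 i)) •
          hadamardVec (stepVec (α i) (vhat i ω)) (m i ω)
        + (β1 i / (1 - β1 i)) •
          hadamardVec (stepVec (α i) (vhat i ω) - stepVec (α (i - 1)) (vhat (i - 1) ω))
            (m (i - 1) ω)
        + hadamardVec (stepVec (α i) (vhat i ω)) (g i ω)) := fun i hi ω =>
    auxiliary_step (hβ i hi).2 rfl (hm i hi ω) (hprev i hi ω) (hx i hi ω) (hz i hi ω)
      (hz (i + 1) (by omega) ω)
  refine integral_le_of_le_neg_add_const_mul ((hint0 _).sub (hint0 _)) hint1 hint2 hint3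
    hint4 hint5 hint6 fun ω => ?_
  have htel : f (z (t + 1) ω) - f (z 1 ω) =
      ∑ i ∈ Finset.Icc 1 t, (f (z (i + 1) ω) - f (z i ω)) := by
    rw [← Finset.Ico_add_one_right_eq_Icc,
      Finset.sum_Ico_sub (fun i => f (z i ω)) (by omega)]
  simp only [htel, ← Finset.sum_neg_distrib, Finset.mul_sum, ← Finset.sum_add_distrib]
  refine Finset.sum_le_sum fun i hi => ?_
  have hi := (Finset.mem_Icc.1 hi).1
  rw [hstep i hi ω, ← real_inner_smul_right, ← hadamardVec_stepVec_eq_smul]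
  refine (sub_le_inner_add_of_lipschitz_gradient hgrad hLip _ _).trans ?_
  rw [norm_neg, inner_neg_right, inner_add_right, inner_add_right]
  have h3 := mul_le_mul_of_nonneg_left (norm_add_add_sq_le
    ((β1 (i + 1) / (1 - β1 (i + 1)) - β1 i / (1 - β1 i)) •
      hadamardVec (stepVec (α i) (vhat i ω)) (m i ω))
    ((β1 i / (1 - β1 i)) •
      hadamardVec (stepVec (α i) (vhat i ω) - stepVec (α (i - 1)) (vhat (i - 1) ω)) (m (i - 1) ω))
    (hadamardVec (stepVec (α i) (vhat i ω)) (g i ω))) (div_nonneg hL zero_le_two)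
  linarith
end

section
/- Suppose β_{1,t} ≤ β₁ < 1 for all t. Then −E[∑_{i=1}^{t} ⟨∇f(z_i), (β_{1,i}/(1−β_{1,i}))(α_i/√v̂_i − α_{i−1}/√v̂_{i−1}) ⊙ m_{i−1}⟩] ≤ H² · (β₁/(1−β₁)) · E[∑_{i=2}^{t} ∑_{j=1}^{d} |(α_i/√v̂_i − α_{i−1}/√v̂_{i−1})_j|]. -/
open MeasureTheory Finset ProbabilityTheory
open scoped RealInnerProductSpace

/-- A vector sequence of weighted averages of vectors of norm at most `H`, started at `0`,
stays in the ball of radius `H`. -/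
theorem norm_momentum_le {E : Type*} [NormedAddCommGroup E] [NormedSpace ℝ E]
    {b : ℕ → ℝ} {m g : ℕ → E} {H : ℝ} (hH : 0 ≤ H)
    (hb : ∀ t, 1 ≤ t → 0 ≤ b t ∧ b t < 1) (hm0 : m 0 = 0)
    (hm : ∀ t, 1 ≤ t → m t = b t • m (t - 1) + (1 - b t) • g t)
    (hg : ∀ t, 1 ≤ t → ‖g t‖ ≤ H) (t : ℕ) : ‖m t‖ ≤ H := by
  induction t with
  | zero => simpa [hm0] using hH
  | succ t ih =>
    obtain ⟨h0, h1⟩ := hb (t + 1) (by omega)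
    rw [hm (t + 1) (by omega), Nat.add_sub_cancel]
    have hmem := (convex_closedBall (0 : E) H) (mem_closedBall_zero_iff.2 ih)
      (mem_closedBall_zero_iff.2 (hg (t + 1) (by omega))) h0 (sub_nonneg.2 h1.le)
      (add_sub_cancel _ _)
    exact mem_closedBall_zero_iff.1 hmem

/-- Hölder-type bound for the inner product with an elementwise product. -/
theorem abs_inner_hadamardVec_le {d : ℕ} {u s w : EuclideanSpace ℝ (Fin d)} {A B : ℝ}
    (hu : ‖u‖ ≤ A) (hw : ‖w‖ ≤ B) :
    |⟪u, hadamardVec s w⟫| ≤ A * B * ∑ j, |s j| := by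
  have hA : 0 ≤ A := (norm_nonneg u).trans hu
  rw [PiLp.inner_apply, Finset.mul_sum]
  refine (Finset.abs_sum_le_sum_abs _ _).trans (Finset.sum_le_sum fun j _ => ?_)
  have huj : |u j| ≤ A := (PiLp.norm_apply_le u j).trans hu
  have hwj : |w j| ≤ B := (PiLp.norm_apply_le w j).trans hw
  calc |inner ℝ (u j) (hadamardVec s w j)| = |u j| * |w j| * |s j| := by
        simp [hadamardVec, abs_mul]; ring
    _ ≤ A * B * |s j| := by gcongr

/-- Lemma A.3 of the paper: bound on the term `T1`:
`-E[∑_{i=1}^t ⟨∇f(z_i), (β_{1,i}/(1-β_{1,i}))(α_i/√v̂_i - α_{i-1}/√v̂_{i-1}) ⊙ m_{i-1}⟩]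
  ≤ H² (β₁/(1-β₁)) E[∑_{i=2}^t ∑_j |(α_i/√v̂_i - α_{i-1}/√v̂_{i-1})_j|]`. -/
theorem generalized_adam_T1_bound
    {d : ℕ} (hd : 1 ≤ d)
    {Ω : Type} [MeasurableSpace Ω] (μ : Measure Ω) [IsProbabilityMeasure μ]
    (α β1 : ℕ → ℝ) (β₁ : ℝ)
    (hα : ∀ t, 1 ≤ t → 0 < α t)
    (hβ : ∀ t, 1 ≤ t → 0 ≤ β1 t ∧ β1 t < 1)
    (hβub : ∀ t, 1 ≤ t → β1 t ≤ β₁) (hβ₁ : β₁ < 1)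
    (g vhat m x z : ℕ → Ω → EuclideanSpace ℝ (Fin d))
    (hgmeas : ∀ t, Measurable (g t))
    (hvfun : ∀ t, 1 ≤ t →
      ∃ h : (Fin t → EuclideanSpace ℝ (Fin d)) → EuclideanSpace ℝ (Fin d),
        Measurable h ∧ ∀ ω, vhat t ω = h fun i => g (i + 1) ω)
    (hvpos : ∀ t, 1 ≤ t → ∀ ω, ∀ j, 0 < vhat t ω j)
    (hm0 : ∀ ω, m 0 ω = 0)
    (hm : ∀ t, 1 ≤ t → ∀ ω, m t ω = β1 t • m (t - 1) ω + (1 - β1 t) • g t ω)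
    (x1 : EuclideanSpace ℝ (Fin d)) (hx1 : ∀ ω, x 1 ω = x1)
    (hx0 : ∀ ω, x 0 ω = x 1 ω)
    (hx : ∀ t, 1 ≤ t → ∀ ω,
      x (t + 1) ω = x t ω - hadamardVec (stepVec (α t) (vhat t ω)) (m t ω))
    (hz : ∀ t, 1 ≤ t → ∀ ω,
      z t ω = x t ω + (β1 t / (1 - β1 t)) • (x t ω - x (t - 1) ω))
    (f : EuclideanSpace ℝ (Fin d) → ℝ)
    (gradf : EuclideanSpace ℝ (Fin d) → EuclideanSpace ℝ (Fin d))
    (hgrad : ∀ p, HasGradientAt f (gradf p) p)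
    (H : ℝ) (hgradbd : ∀ p, ‖gradf p‖ ≤ H)
    (hgbd : ∀ t, 1 ≤ t → ∀ᵐ ω ∂μ, ‖g t ω‖ ≤ H)
    (t : ℕ) (ht : 1 ≤ t)
    (hint1 : Integrable (fun ω => ∑ i ∈ Finset.Icc 1 t,
      ⟪gradf (z i ω), (β1 i / (1 - β1 i)) •
        hadamardVec (stepVec (α i) (vhat i ω) - stepVec (α (i - 1)) (vhat (i - 1) ω))
          (m (i - 1) ω)⟫) μ)
    (hint2 : Integrable (fun ω => ∑ i ∈ Finset.Icc 2 t, ∑ j,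
      |(stepVec (α i) (vhat i ω) - stepVec (α (i - 1)) (vhat (i - 1) ω)) j|) μ) :
    -(∫ ω, (∑ i ∈ Finset.Icc 1 t,
        ⟪gradf (z i ω), (β1 i / (1 - β1 i)) •
          hadamardVec (stepVec (α i) (vhat i ω) - stepVec (α (i - 1)) (vhat (i - 1) ω))
            (m (i - 1) ω)⟫) ∂μ)
      ≤ H ^ 2 * (β₁ / (1 - β₁)) *
        (∫ ω, (∑ i ∈ Finset.Icc 2 t, ∑ j,
          |(stepVec (α i) (vhat i ω) - stepVec (α (i - 1)) (vhat (i - 1) ω)) j|) ∂μ) := by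
  have hH : 0 ≤ H := (norm_nonneg _).trans (hgradbd 0)
  rw [← integral_neg, ← integral_const_mul]
  refine integral_mono_ae hint1.neg (hint2.const_mul _) ?_
  have hg_all : ∀ᵐ ω ∂μ, ∀ i, 1 ≤ i → ‖g i ω‖ ≤ H :=
    ae_all_iff.2 fun i => ae_all_iff.2 fun hi => hgbd i hi
  filter_upwards [hg_all] with ω hω
  have hmb : ∀ i, ‖m i ω‖ ≤ H :=
    norm_momentum_le hH hβ (hm0 ω) (fun i hi => hm i hi ω) hω
  rw [← Finset.add_sum_Ioc_eq_sum_Icc ht]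
  have hIoc : Finset.Ioc 1 t = Finset.Icc 2 t := by ext; simp; omega
  have hfirst : hadamardVec
      (stepVec (α 1) (vhat 1 ω) - stepVec (α (1 - 1)) (vhat (1 - 1) ω)) (m (1 - 1) ω) = 0 := by
    ext j
    simp [hadamardVec, hm0 ω]
  rw [hIoc, hfirst, smul_zero, inner_zero_right, zero_add, ← Finset.sum_neg_distrib,
    Finset.mul_sum]
  refine Finset.sum_le_sum fun i hi => ?_
  have hi1 : 1 ≤ i := by have := (Finset.mem_Icc.1 hi).1; omega
  obtain ⟨hb0, hb1⟩ := hβ i hi1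
  have hc0 : 0 ≤ β1 i / (1 - β1 i) := div_nonneg hb0 (sub_nonneg.2 hb1.le)
  have hc : β1 i / (1 - β1 i) ≤ β₁ / (1 - β₁) :=
    div_le_div₀ (hb0.trans (hβub i hi1)) (hβub i hi1) (sub_pos.2 hβ₁)
      (sub_le_sub_left (hβub i hi1) 1)
  rw [real_inner_smul_right]
  set s := stepVec (α i) (vhat i ω) - stepVec (α (i - 1)) (vhat (i - 1) ω)
  have hinner : -⟪gradf (z i ω), hadamardVec s (m (i - 1) ω)⟫ ≤ H * H * ∑ j, |s j| :=
    (neg_le_abs _).trans (abs_inner_hadamardVec_le (hgradbd _) (hmb _))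
  have hS : 0 ≤ H * H * ∑ j, |s j| :=
    mul_nonneg (mul_nonneg hH hH) (Finset.sum_nonneg fun j _ => abs_nonneg _)
  calc -(β1 i / (1 - β1 i) * ⟪gradf (z i ω), hadamardVec s (m (i - 1) ω)⟫)
      = β1 i / (1 - β1 i) * -⟪gradf (z i ω), hadamardVec s (m (i - 1) ω)⟫ := by ring
    _ ≤ β1 i / (1 - β1 i) * (H * H * ∑ j, |s j|) := mul_le_mul_of_nonneg_left hinner hc0
    _ ≤ β₁ / (1 - β₁) * (H * H * ∑ j, |s j|) := mul_le_mul_of_nonneg_right hc hS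
    _ = H ^ 2 * (β₁ / (1 - β₁)) * ∑ j, |s j| := by ring
end

section
/- Suppose β_{1,t} ≤ β₁ < 1 for all t, the sequence β_{1,t} is non-increasing, and ‖α_i m_i/√v̂_i‖ ≤ G almost surely for all i. Then −E[∑_{i=1}^{t} ⟨∇f(z_i), (β_{1,i+1}/(1−β_{1,i+1}) − β_{1,i}/(1−β_{1,i})) α_i m_i/√v̂_i⟩] ≤ (β₁/(1−β₁) − β_{1,t+1}/(1−β_{1,t+1})) · (H² + G²). -/
open MeasureTheory Finset ProbabilityTheory
open scoped RealInnerProductSpace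

/-- The map `b ↦ b / (1 - b)` is monotone below `1`. -/
theorem div_one_sub_le_div_one_sub {a b : ℝ} (hab : a ≤ b) (hb : b < 1) :
    a / (1 - a) ≤ b / (1 - b) := by
  rw [div_le_div_iff₀ (by linarith) (by linarith)]
  linarith

/-- Young's inequality for inner products of bounded vectors. -/
theorem inner_le_sq_add_sq_of_norm_le {E : Type*} [NormedAddCommGroup E]
    [InnerProductSpace ℝ E] {u v : E} {H G : ℝ} (hu : ‖u‖ ≤ H) (hv : ‖v‖ ≤ G) :
    ⟪u, v⟫ ≤ H ^ 2 + G ^ 2 := by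
  have hu2 : ‖u‖ ^ 2 ≤ H ^ 2 := by gcongr
  have hv2 : ‖v‖ ^ 2 ≤ G ^ 2 := by gcongr
  nlinarith [real_inner_le_norm u v, sq_nonneg (‖u‖ - ‖v‖), sq_nonneg ‖u‖, sq_nonneg ‖v‖]

/-- An Abel-type bound: antitone weights `r` telescope against bounded inner products. -/
theorem neg_sum_inner_smul_le {E : Type*} [NormedAddCommGroup E] [InnerProductSpace ℝ E]
    {r : ℕ → ℝ} {u v : ℕ → E} {H G : ℝ} {t : ℕ}
    (hr : ∀ i ∈ Finset.Icc 1 t, r (i + 1) ≤ r i)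
    (hu : ∀ i ∈ Finset.Icc 1 t, ‖u i‖ ≤ H) (hv : ∀ i ∈ Finset.Icc 1 t, ‖v i‖ ≤ G) :
    -(∑ i ∈ Finset.Icc 1 t, ⟪u i, (r (i + 1) - r i) • v i⟫)
      ≤ (r 1 - r (t + 1)) * (H ^ 2 + G ^ 2) := by
  calc -(∑ i ∈ Finset.Icc 1 t, ⟪u i, (r (i + 1) - r i) • v i⟫)
      = ∑ i ∈ Finset.Icc 1 t, (r i - r (i + 1)) * ⟪u i, v i⟫ := by
        rw [← Finset.sum_neg_distrib]
        refine Finset.sum_congr rfl fun i _ => ?_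
        rw [real_inner_smul_right]
        ring
    _ ≤ ∑ i ∈ Finset.Icc 1 t, (r i - r (i + 1)) * (H ^ 2 + G ^ 2) :=
        Finset.sum_le_sum fun i hi => mul_le_mul_of_nonneg_left
          (inner_le_sq_add_sq_of_norm_le (hu i hi) (hv i hi)) (sub_nonneg.2 (hr i hi))
    _ = (r 1 - r (t + 1)) * (H ^ 2 + G ^ 2) := by
        rw [← Finset.sum_mul, ← Finset.Ico_add_one_right_eq_Icc,
          ← neg_sub (r (t + 1)), ← Finset.sum_Ico_sub r (by omega : 1 ≤ t + 1),
          ← Finset.sum_neg_distrib]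
        simp only [neg_sub]

/-- Lemma A.4 of the paper: bound on the term `T3`:
`-E[∑_{i=1}^t ⟨∇f(z_i), (β_{1,i+1}/(1-β_{1,i+1}) - β_{1,i}/(1-β_{1,i})) α_i m_i/√v̂_i⟩]
  ≤ (β₁/(1-β₁) - β_{1,t+1}/(1-β_{1,t+1})) (H² + G²)`. -/
theorem generalized_adam_T3_bound
    {d : ℕ} (hd : 1 ≤ d)
    {Ω : Type} [MeasurableSpace Ω] (μ : Measure Ω) [IsProbabilityMeasure μ]
    (α β1 : ℕ → ℝ) (β₁ : ℝ)
    (hα : ∀ t, 1 ≤ t → 0 < α t)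
    (hβ : ∀ t, 1 ≤ t → 0 ≤ β1 t ∧ β1 t < 1)
    (hβub : ∀ t, 1 ≤ t → β1 t ≤ β₁) (hβ₁ : β₁ < 1)
    (hβmono : ∀ t, 1 ≤ t → β1 (t + 1) ≤ β1 t)
    (g vhat m x z : ℕ → Ω → EuclideanSpace ℝ (Fin d))
    (hgmeas : ∀ t, Measurable (g t))
    (hvfun : ∀ t, 1 ≤ t →
      ∃ h : (Fin t → EuclideanSpace ℝ (Fin d)) → EuclideanSpace ℝ (Fin d),
        Measurable h ∧ ∀ ω, vhat t ω = h fun i => g (i + 1) ω)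
    (hvpos : ∀ t, 1 ≤ t → ∀ ω, ∀ j, 0 < vhat t ω j)
    (hm0 : ∀ ω, m 0 ω = 0)
    (hm : ∀ t, 1 ≤ t → ∀ ω, m t ω = β1 t • m (t - 1) ω + (1 - β1 t) • g t ω)
    (x1 : EuclideanSpace ℝ (Fin d)) (hx1 : ∀ ω, x 1 ω = x1)
    (hx0 : ∀ ω, x 0 ω = x 1 ω)
    (hx : ∀ t, 1 ≤ t → ∀ ω,
      x (t + 1) ω = x t ω - hadamardVec (stepVec (α t) (vhat t ω)) (m t ω))
    (hz : ∀ t, 1 ≤ t → ∀ ω,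
      z t ω = x t ω + (β1 t / (1 - β1 t)) • (x t ω - x (t - 1) ω))
    (f : EuclideanSpace ℝ (Fin d) → ℝ)
    (gradf : EuclideanSpace ℝ (Fin d) → EuclideanSpace ℝ (Fin d))
    (hgrad : ∀ p, HasGradientAt f (gradf p) p)
    (H : ℝ) (hgradbd : ∀ p, ‖gradf p‖ ≤ H)
    (hgbd : ∀ t, 1 ≤ t → ∀ᵐ ω ∂μ, ‖g t ω‖ ≤ H)
    (G : ℝ)
    (hG : ∀ i, 1 ≤ i → ∀ᵐ ω ∂μ,
      ‖hadamardVec (stepVec (α i) (vhat i ω)) (m i ω)‖ ≤ G)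
    (t : ℕ) (ht : 1 ≤ t)
    (hint : Integrable (fun ω => ∑ i ∈ Finset.Icc 1 t,
      ⟪gradf (z i ω), (β1 (i + 1) / (1 - β1 (i + 1)) - β1 i / (1 - β1 i)) •
        hadamardVec (stepVec (α i) (vhat i ω)) (m i ω)⟫) μ) :
    -(∫ ω, (∑ i ∈ Finset.Icc 1 t,
        ⟪gradf (z i ω), (β1 (i + 1) / (1 - β1 (i + 1)) - β1 i / (1 - β1 i)) •
          hadamardVec (stepVec (α i) (vhat i ω)) (m i ω)⟫) ∂μ)
      ≤ (β₁ / (1 - β₁) - β1 (t + 1) / (1 - β1 (t + 1))) * (H ^ 2 + G ^ 2) := by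
  rw [← integral_neg]
  have hbound : ∀ᵐ ω ∂μ, -(∑ i ∈ Finset.Icc 1 t,
      ⟪gradf (z i ω), (β1 (i + 1) / (1 - β1 (i + 1)) - β1 i / (1 - β1 i)) •
        hadamardVec (stepVec (α i) (vhat i ω)) (m i ω)⟫)
      ≤ (β₁ / (1 - β₁) - β1 (t + 1) / (1 - β1 (t + 1))) * (H ^ 2 + G ^ 2) := by
    have hG' : ∀ᵐ ω ∂μ, ∀ i, 1 ≤ i →
        ‖hadamardVec (stepVec (α i) (vhat i ω)) (m i ω)‖ ≤ G :=
      ae_all_iff.2 fun i => Filter.eventually_imp_distrib_left.2 (hG i)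
    filter_upwards [hG'] with ω hω
    refine (neg_sum_inner_smul_le (r := fun i => β1 i / (1 - β1 i)) (H := H) (G := G)
      (fun i hi => ?_) (fun i _ => hgradbd _)
      fun i hi => hω i (Finset.mem_Icc.1 hi).1).trans ?_
    · have hi1 := (Finset.mem_Icc.1 hi).1
      exact div_one_sub_le_div_one_sub (hβmono i hi1) (hβ i hi1).2
    · refine mul_le_mul_of_nonneg_right (sub_le_sub_right ?_ _) (by positivity)
      exact div_one_sub_le_div_one_sub (hβub 1 le_rfl) hβ₁
  calc _ ≤ ∫ _, (β₁ / (1 - β₁) - β1 (t + 1) / (1 - β1 (t + 1))) * (H ^ 2 + G ^ 2) ∂μ :=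
        integral_mono_ae hint.neg (integrable_const _) hbound
    _ = _ := by simp
end

section
/- Let a_i ≥ 0 be real numbers, let β ∈ [0,1), and for each i ≥ 1 define b_i = ∑_{k=1}^{i} β^{i−k} ∑_{l=k+1}^{i} a_l. Then for every t ≥ 1: ∑_{i=1}^{t} b_i² ≤ (1/(1−β))² (β/(1−β))² ∑_{i=2}^{t} a_i². -/
/-- A power sum of a contraction factor, taken from the first power on, is at most `β / (1 - β)`. -/
lemma sum_Icc_pow_succ_sub_le {β : ℝ} (hβ0 : 0 ≤ β) (hβ1 : β < 1) (i : ℕ) :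
    ∑ k ∈ Finset.Icc 1 i, β ^ (i + 1 - k) ≤ β / (1 - β) := by
  have h1 : 0 < 1 - β := sub_pos.2 hβ1
  induction i with
  | zero => simpa using div_nonneg hβ0 h1.le
  | succ i ih =>
    have hstep : ∑ k ∈ Finset.Icc 1 (i + 1), β ^ (i + 1 + 1 - k) =
        β * ∑ k ∈ Finset.Icc 1 i, β ^ (i + 1 - k) + β := by
      rw [Finset.sum_Icc_succ_top (by omega), Finset.mul_sum]
      congr 1
      · refine Finset.sum_congr rfl fun k hk => ?_
        rw [Finset.mem_Icc] at hk
        rw [← pow_succ']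
        congr 1
        omega
      · simp
    calc _ = β * ∑ k ∈ Finset.Icc 1 i, β ^ (i + 1 - k) + β := hstep
      _ ≤ β * (β / (1 - β)) + β := by gcongr
      _ = β / (1 - β) := by field_simp; ring

/-- The exponentially weighted sum of tail sums satisfies a first-order linear recursion. -/
lemma sum_pow_mul_sum_Icc_succ (a : ℕ → ℝ) (β : ℝ) (i : ℕ) :
    ∑ k ∈ Finset.Icc 1 (i + 1), β ^ (i + 1 - k) * ∑ l ∈ Finset.Icc (k + 1) (i + 1), a l =
      β * ∑ k ∈ Finset.Icc 1 i, β ^ (i - k) * ∑ l ∈ Finset.Icc (k + 1) i, a l +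
        (∑ k ∈ Finset.Icc 1 i, β ^ (i + 1 - k)) * a (i + 1) := by
  rw [Finset.sum_Icc_succ_top (by omega), Finset.Icc_eq_empty_of_lt (Nat.lt_succ_self (i + 1)),
    Finset.sum_empty, mul_zero, add_zero, Finset.mul_sum, Finset.sum_mul,
    ← Finset.sum_add_distrib]
  refine Finset.sum_congr rfl fun k hk => ?_
  rw [Finset.mem_Icc] at hk
  rw [Finset.sum_Icc_succ_top (by omega), show i + 1 - k = i - k + 1 by omega, pow_succ']
  ring

/-- Convexity of the square, for a combination with weights `β` and `1 - β`. -/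
lemma sq_mul_add_le {β : ℝ} (hβ0 : 0 ≤ β) (hβ1 : β < 1) (x y : ℝ) :
    (β * x + y) ^ 2 ≤ β * x ^ 2 + y ^ 2 / (1 - β) := by
  have h1 : 0 < 1 - β := sub_pos.2 hβ1
  have h : β * x ^ 2 + y ^ 2 / (1 - β) - (β * x + y) ^ 2 =
      β * ((1 - β) * x - y) ^ 2 / (1 - β) := by
    field_simp
    ring
  have : 0 ≤ β * ((1 - β) * x - y) ^ 2 / (1 - β) := by positivity
  linarith


/-- Lemma A.8 of the paper: for nonnegative reals `a_i`, `β ∈ [0,1)` and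
`b_i = ∑_{k=1}^i β^{i-k} ∑_{l=k+1}^i a_l`, one has
`∑_{i=1}^t b_i² ≤ (1/(1-β))² (β/(1-β))² ∑_{i=2}^t a_i²`. -/
theorem sum_sq_exp_weighted_bound
    (a : ℕ → ℝ) (ha : ∀ i, 0 ≤ a i)
    (β : ℝ) (hβ0 : 0 ≤ β) (hβ1 : β < 1)
    (b : ℕ → ℝ)
    (hb : ∀ i, 1 ≤ i →
      b i = ∑ k ∈ Finset.Icc 1 i, β ^ (i - k) * ∑ l ∈ Finset.Icc (k + 1) i, a l) :
    ∀ t, 1 ≤ t →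
      ∑ i ∈ Finset.Icc 1 t, (b i) ^ 2 ≤
        (1 / (1 - β)) ^ 2 * (β / (1 - β)) ^ 2 * ∑ i ∈ Finset.Icc 2 t, (a i) ^ 2 := by
  have h1 : 0 < 1 - β := sub_pos.2 hβ1
  have hb_nonneg : ∀ i, 1 ≤ i → 0 ≤ b i := fun i hi => by
    rw [hb i hi]
    exact Finset.sum_nonneg fun k _ =>
      mul_nonneg (pow_nonneg hβ0 _) (Finset.sum_nonneg fun l _ => ha l)
  have hb_succ : ∀ i, 1 ≤ i → b (i + 1) ≤ β * b i + β / (1 - β) * a (i + 1) := fun i hi => by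
    rw [hb (i + 1) (by omega), sum_pow_mul_sum_Icc_succ, ← hb i hi]
    gcongr
    · exact ha _
    · exact sum_Icc_pow_succ_sub_le hβ0 hβ1 i
  have key : ∀ t, 1 ≤ t → ∑ i ∈ Finset.Icc 1 t, (b i) ^ 2 + β / (1 - β) * (b t) ^ 2 ≤
      (1 / (1 - β)) ^ 2 * (β / (1 - β)) ^ 2 * ∑ i ∈ Finset.Icc 2 t, (a i) ^ 2 := by
    intro t ht
    induction t, ht using Nat.le_induction with
    | base => simp [hb 1 le_rfl]
    | succ t ht ih =>
      have hsq : (b (t + 1)) ^ 2 ≤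
          β * (b t) ^ 2 + (β / (1 - β) * a (t + 1)) ^ 2 / (1 - β) :=
        (pow_le_pow_left₀ (hb_nonneg _ (by omega)) (hb_succ t ht) 2).trans
          (sq_mul_add_le hβ0 hβ1 _ _)
      rw [Finset.sum_Icc_succ_top (by omega), Finset.sum_Icc_succ_top (by omega)]
      have hlast : (b (t + 1)) ^ 2 + β / (1 - β) * (b (t + 1)) ^ 2 ≤ β / (1 - β) * (b t) ^ 2 +
          (1 / (1 - β)) ^ 2 * (β / (1 - β)) ^ 2 * (a (t + 1)) ^ 2 := by
        calc _ = (b (t + 1)) ^ 2 / (1 - β) := by field_simp; ring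
          _ ≤ (β * (b t) ^ 2 + (β / (1 - β) * a (t + 1)) ^ 2 / (1 - β)) / (1 - β) := by gcongr
          _ = _ := by field_simp
      linarith
  intro t ht
  have : 0 ≤ β / (1 - β) * (b t) ^ 2 := by positivity
  linarith [key t ht]
end

section
/- Let a_1, a_2, … be nonnegative real numbers with a_1 > 0 (so that all partial sums ∑_{i=1}^{t} a_i are nonzero). Then for every T ≥ 1: ∑_{t=1}^{T} a_t/(∑_{i=1}^{t} a_i) ≤ 1 − log a_1 + log(∑_{i=1}^{T} a_i), where log is the natural logarithm. -/
theorem div_add_le_log_add_sub_log {s x : ℝ} (hs : 0 < s) (hx : 0 ≤ x) :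
    x / (s + x) ≤ Real.log (s + x) - Real.log s := by
  have hsx : 0 < s + x := by positivity
  have h := Real.log_le_sub_one_of_pos (div_pos hs hsx)
  rw [Real.log_div hs.ne' hsx.ne'] at h
  have h' : x / (s + x) = 1 - s / (s + x) := by field_simp; ring
  linarith

/-- Lemma A.9 of the paper: for nonnegative reals with `a_1 > 0`,
`∑_{t=1}^T a_t / (∑_{i=1}^t a_i) ≤ 1 - log a_1 + log (∑_{i=1}^T a_i)`. -/
theorem sum_ratio_log_bound
    (a : ℕ → ℝ) (ha : ∀ i, 1 ≤ i → 0 ≤ a i) (ha1 : 0 < a 1) :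
    ∀ T, 1 ≤ T →
      ∑ t ∈ Finset.Icc 1 T, a t / (∑ i ∈ Finset.Icc 1 t, a i) ≤
        1 - Real.log (a 1) + Real.log (∑ i ∈ Finset.Icc 1 T, a i) := by
  intro T hT
  induction T, hT using Nat.le_induction with
  | base => simp [div_self ha1.ne']
  | succ n hn ih =>
    have hpos : 0 < ∑ i ∈ Finset.Icc 1 n, a i :=
      Finset.sum_pos' (fun i hi => ha i (Finset.mem_Icc.1 hi).1)
        ⟨1, Finset.mem_Icc.2 ⟨le_rfl, hn⟩, ha1⟩
    have hstep := div_add_le_log_add_sub_log hpos (ha (n + 1) n.succ_pos)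
    rw [Finset.sum_Icc_succ_top n.succ_pos, Finset.sum_Icc_succ_top n.succ_pos]
    linarith
end

section
/- Let β₁ ∈ [0,1), let β_{1,l} ∈ [0, β₁] for each l ≥ 1, and let a_1, a_2, … be real numbers. Then for every t ≥ 2: ∑_{i=2}^{t} ( ∑_{k=1}^{i−1} ( ∏_{l=k+1}^{i−1} β_{1,l} ) (1−β_{1,k}) a_k )² ≤ (1/(1−β₁))² ∑_{k=1}^{t−1} a_k², where the empty product equals 1. -/
/-- The momentum-type weighted sum `∑_{k=1}^n (∏_{l=k+1}^n b l) (1 - b k) a k`. -/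
noncomputable def weightedMomentumSum (b a : ℕ → ℝ) (n : ℕ) : ℝ :=
  ∑ k ∈ Finset.Icc 1 n, (∏ l ∈ Finset.Icc (k + 1) n, b l) * (1 - b k) * a k

theorem weightedMomentumSum_zero (b a : ℕ → ℝ) : weightedMomentumSum b a 0 = 0 := by
  simp [weightedMomentumSum]

theorem weightedMomentumSum_succ (b a : ℕ → ℝ) (n : ℕ) :
    weightedMomentumSum b a (n + 1) =
      b (n + 1) * weightedMomentumSum b a n + (1 - b (n + 1)) * a (n + 1) := by
  unfold weightedMomentumSum
  rw [Finset.sum_Icc_succ_top (by omega), Finset.mul_sum]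
  congr 1
  · refine Finset.sum_congr rfl fun k hk => ?_
    have hk' := (Finset.mem_Icc.mp hk).2
    rw [Finset.prod_Icc_succ_top (by omega)]
    ring
  · simp

theorem sq_convex_combination_le {c β x y : ℝ} (hc0 : 0 ≤ c) (hcβ : c ≤ β) (hβ : β ≤ 1) :
    (c * x + (1 - c) * y) ^ 2 ≤ β * x ^ 2 + y ^ 2 := by
  nlinarith [mul_nonneg (mul_nonneg hc0 (by linarith : 0 ≤ 1 - c)) (sq_nonneg (x - y)),
    mul_nonneg (sub_nonneg.mpr hcβ) (sq_nonneg x), mul_nonneg hc0 (sq_nonneg y)]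

/-- Summing the one-step contraction of the squares telescopes. -/
theorem sum_sq_weightedMomentumSum_add_le {β : ℝ} (hβ1 : β ≤ 1) {b : ℕ → ℝ}
    (hb : ∀ l, 1 ≤ l → 0 ≤ b l ∧ b l ≤ β) (a : ℕ → ℝ) (n : ℕ) :
    (1 - β) * ∑ i ∈ Finset.Icc 2 (n + 1), weightedMomentumSum b a (i - 1) ^ 2
        + β * weightedMomentumSum b a n ^ 2
      ≤ ∑ k ∈ Finset.Icc 1 n, a k ^ 2 := by
  induction n with
  | zero => simp [weightedMomentumSum_zero]
  | succ n ih =>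
    rw [Finset.sum_Icc_succ_top (by omega : 2 ≤ n + 1 + 1),
      Finset.sum_Icc_succ_top (by omega : 1 ≤ n + 1), Nat.add_sub_cancel]
    obtain ⟨h0, h1⟩ := hb (n + 1) (by omega)
    have h := sq_convex_combination_le (x := weightedMomentumSum b a n) (y := a (n + 1))
      h0 h1 hβ1
    rw [← weightedMomentumSum_succ] at h
    linarith

/-- with `β₁ ∈ [0,1)`, `β_{1,l} ∈ [0, β₁]`, and real numbers `a_k`,
`∑_{i=2}^t (∑_{k=1}^{i-1} (∏_{l=k+1}^{i-1} β_{1,l})(1-β_{1,k}) a_k)²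
   ≤ (1/(1-β₁))² ∑_{k=1}^{t-1} a_k²` (empty products equal 1, empty sums 0). -/
theorem weighted_momentum_sum_sq_bound
    (β₁ : ℝ) (hβ₁0 : 0 ≤ β₁) (hβ₁1 : β₁ < 1)
    (β1 : ℕ → ℝ) (hβ : ∀ l, 1 ≤ l → 0 ≤ β1 l ∧ β1 l ≤ β₁)
    (a : ℕ → ℝ) :
    ∀ t, 2 ≤ t →
      ∑ i ∈ Finset.Icc 2 t,
        (∑ k ∈ Finset.Icc 1 (i - 1),
          (∏ l ∈ Finset.Icc (k + 1) (i - 1), β1 l) * (1 - β1 k) * a k) ^ 2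
      ≤ (1 / (1 - β₁)) ^ 2 * ∑ k ∈ Finset.Icc 1 (t - 1), (a k) ^ 2 := by
  intro t ht
  obtain ⟨n, rfl⟩ : ∃ n, t = n + 1 := ⟨t - 1, by omega⟩
  have h := sum_sq_weightedMomentumSum_add_le hβ₁1.le hβ a n
  have hpos : 0 < 1 - β₁ := sub_pos.mpr hβ₁1
  have hlast : 0 ≤ β₁ * weightedMomentumSum β1 a n ^ 2 := by positivity
  have hone : 1 ≤ 1 / (1 - β₁) := by rw [le_div_iff₀ hpos]; linarith
  change ∑ i ∈ Finset.Icc 2 (n + 1), weightedMomentumSum β1 a (i - 1) ^ 2 ≤ _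
  rw [Nat.add_sub_cancel]
  calc ∑ i ∈ Finset.Icc 2 (n + 1), weightedMomentumSum β1 a (i - 1) ^ 2
      ≤ 1 / (1 - β₁) * ∑ k ∈ Finset.Icc 1 n, a k ^ 2 := by
        rw [one_div_mul_eq_div, le_div_iff₀ hpos]
        linarith
    _ ≤ (1 / (1 - β₁)) ^ 2 * ∑ k ∈ Finset.Icc 1 n, a k ^ 2 := by
        gcongr
        exact le_self_pow₀ hone two_ne_zero
end

section
/- Let H > 0, let g_t ∈ R^d satisfy ‖g_t‖ ≤ H (Euclidean norm) for all t with |(g_1)_j| ≥ c > 0 for every coordinate j, set v̂_t = (1/t) ∑_{i=1}^{t} g_i² (elementwise squares) and α_t = 1/√t. Then for every T ≥ 1: ∑_{t=1}^{T} ‖α_t g_t/√v̂_t‖² ≤ d(1 − log(c²) + 2 log H + log T), where the division g_t/√v̂_t is elementwise and log is the natural logarithm. -/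
/-- For a nonnegative sequence with positive first term, the sum of the ratios of the terms to the
partial sums grows at most logarithmically in the partial sums. -/
theorem sum_div_partialSum_le_log {a : ℕ → ℝ} (ha : ∀ t, 1 ≤ t → 0 ≤ a t) (ha1 : 0 < a 1)
    {T : ℕ} (hT : 1 ≤ T) :
    ∑ t ∈ Finset.Icc 1 T, a t / ∑ i ∈ Finset.Icc 1 t, a i
      ≤ 1 - Real.log (a 1) + Real.log (∑ i ∈ Finset.Icc 1 T, a i) := by
  induction T, hT using Nat.le_induction with
  | base => simp [ha1.ne']
  | succ n hn ih =>
    have hS : 0 < ∑ i ∈ Finset.Icc 1 n, a i :=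
      ha1.trans_le (Finset.single_le_sum (f := a)
        (fun i hi => ha i (Finset.mem_Icc.1 hi).1) (Finset.mem_Icc.2 ⟨le_rfl, hn⟩))
    have hb := ha (n + 1) (by omega)
    rw [Finset.sum_Icc_succ_top (by omega : 1 ≤ n + 1),
      Finset.sum_Icc_succ_top (by omega : 1 ≤ n + 1) a]
    set S := ∑ i ∈ Finset.Icc 1 n, a i
    have hS' : 0 < S + a (n + 1) := by linarith
    have hlog := Real.log_le_sub_one_of_pos (div_pos hS hS')
    rw [Real.log_div hS.ne' hS'.ne'] at hlog
    have hratio : a (n + 1) / (S + a (n + 1)) = 1 - S / (S + a (n + 1)) := by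
      field_simp
      ring
    linarith


/-- for the AdaGrad weighting `v̂_t = (1/t)∑_{i=1}^t g_i²` and stepsize
`α_t = 1/√t`, with `‖g_t‖ ≤ H` and `|(g_1)_j| ≥ c > 0`,
`∑_{t=1}^T ‖α_t g_t/√v̂_t‖² ≤ d (1 - log c² + 2 log H + log T)`. -/
theorem adagrad_sum_sq_update_bound
    {d : ℕ} (hd : 1 ≤ d)
    (H c : ℝ) (hH : 0 < H) (hc : 0 < c)
    (g vhat : ℕ → EuclideanSpace ℝ (Fin d))
    (hg : ∀ t, 1 ≤ t → ‖g t‖ ≤ H)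
    (hg1 : ∀ j, c ≤ |g 1 j|)
    (hvdef : ∀ t, 1 ≤ t → ∀ j,
      vhat t j = (1 / (t : ℝ)) * ∑ i ∈ Finset.Icc 1 t, (g i j) ^ 2) :
    ∀ T : ℕ, 1 ≤ T →
      ∑ t ∈ Finset.Icc 1 T,
          ‖((EuclideanSpace.equiv (Fin d) ℝ).symm fun j =>
              (1 / Real.sqrt (t : ℝ)) * g t j / Real.sqrt (vhat t j))‖ ^ 2
        ≤ d * (1 - Real.log (c ^ 2) + 2 * Real.log H + Real.log T) := by
  intro T hT
  have hsq : ∀ t ∈ Finset.Icc 1 T,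
      ‖((EuclideanSpace.equiv (Fin d) ℝ).symm fun j =>
          (1 / Real.sqrt (t : ℝ)) * g t j / Real.sqrt (vhat t j))‖ ^ 2
        = ∑ j, (g t j) ^ 2 / ∑ i ∈ Finset.Icc 1 t, (g i j) ^ 2 := by
    intro t ht
    have ht1 := (Finset.mem_Icc.1 ht).1
    have ht0 : (0 : ℝ) < t := by exact_mod_cast ht1
    rw [EuclideanSpace.real_norm_sq_eq]
    refine Finset.sum_congr rfl fun j _ => ?_
    have hsum : 0 ≤ ∑ i ∈ Finset.Icc 1 t, (g i j) ^ 2 :=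
      Finset.sum_nonneg fun i _ => sq_nonneg _
    change ((1 / Real.sqrt (t : ℝ)) * g t j / Real.sqrt (vhat t j)) ^ 2 = _
    rw [hvdef t ht1 j, div_pow, mul_pow, div_pow, Real.sq_sqrt ht0.le,
      Real.sq_sqrt (by positivity), one_pow, mul_div_mul_left _ _ (by positivity)]
  rw [Finset.sum_congr rfl hsq, Finset.sum_comm]
  have hcoord : ∀ j ∈ (Finset.univ : Finset (Fin d)),
      ∑ t ∈ Finset.Icc 1 T, (g t j) ^ 2 / ∑ i ∈ Finset.Icc 1 t, (g i j) ^ 2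
        ≤ 1 - Real.log (c ^ 2) + 2 * Real.log H + Real.log T := by
    intro j _
    have hc1 : c ^ 2 ≤ (g 1 j) ^ 2 := by
      rw [← sq_abs (g 1 j)]
      exact pow_le_pow_left₀ hc.le (hg1 j) 2
    have hpos : 0 < (g 1 j) ^ 2 := (pow_pos hc 2).trans_le hc1
    have hmain := sum_div_partialSum_le_log (a := fun t => (g t j) ^ 2)
      (fun t _ => sq_nonneg _) hpos hT
    have hSpos : 0 < ∑ i ∈ Finset.Icc 1 T, (g i j) ^ 2 :=
      hpos.trans_le (Finset.single_le_sum (f := fun i => (g i j) ^ 2)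
        (fun i _ => sq_nonneg _) (Finset.mem_Icc.2 ⟨le_rfl, hT⟩))
    have hSle : ∑ i ∈ Finset.Icc 1 T, (g i j) ^ 2 ≤ T * H ^ 2 := by
      refine (Finset.sum_le_card_nsmul _ _ (H ^ 2) fun i hi => ?_).trans_eq (by simp)
      rw [← sq_abs (g i j)]
      exact pow_le_pow_left₀ (abs_nonneg _)
        ((PiLp.norm_apply_le (g i) j).trans (hg i (Finset.mem_Icc.1 hi).1)) 2
    have hT0 : (T : ℝ) ≠ 0 := by exact_mod_cast (by omega : T ≠ 0)
    have hlogS := Real.log_le_log hSpos hSle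
    rw [Real.log_mul hT0 (by positivity), Real.log_pow] at hlogS
    have hlogc := Real.log_le_log (pow_pos hc 2) hc1
    push_cast at hlogS
    linarith
  exact (Finset.sum_le_card_nsmul _ _ _ hcoord).trans_eq (by
    rw [Finset.card_univ, Fintype.card_fin, nsmul_eq_mul])
end
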